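/- If (S, H) is admissible with d(S) = 36 and h_m(S,H) = 0 for every m with 1 ≤ m ≤ 9, then H = 23/840 and S is the multiset {1/8, 3/7, 1/5, 1/4, 1/3, 1/3, 1/2, 0, 0, 0, 0}. -/

import Mathlib

/-- The periodized second Bernoulli polynomial `B(x) = {x}² − {x} + 1/6`. -/
def bernB (x : ℚ) : ℚ := Int.fract x ^ 2 - Int.fract x + 1 / 6

/-- `d(S) = Σ_{z ∈ S} den(z)`: the sum of the denominators (in lowest terms)
of the elements of the multiset `S`. -/
def dS (S : Multiset ℚ) : ℕ := (S.map fun z => z.den).sum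

/-- `λ_m(S) = Σ_{z ∈ S} den(z)·B(m·z)`. -/
def lamS (m : ℕ) (S : Multiset ℚ) : ℚ :=
  (S.map fun z => (z.den : ℚ) * bernB (m * z)).sum

/-- `h_m(S,H) = m²·H − λ_m(S)`. -/
def hS (m : ℕ) (S : Multiset ℚ) (H : ℚ) : ℚ := (m : ℚ) ^ 2 * H - lamS m S

/-- `(S, H)` is admissible: `S` is a multiset of rationals in `[0, 1/2]`, `H > 0`,
each `h_m(S,H)` is a nonnegative even integer, and `h_{m′}(S,H) ≤ h_m(S,H)`
whenever `m′ ∣ m`. -/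
def Admissible (S : Multiset ℚ) (H : ℚ) : Prop :=
  (∀ z ∈ S, 0 ≤ z ∧ z ≤ 1 / 2) ∧ 0 < H ∧
  (∀ m : ℕ, 0 < m → ∃ k : ℕ, hS m S H = 2 * k) ∧
  (∀ m m' : ℕ, 0 < m' → 0 < m → m' ∣ m → hS m' S H ≤ hS m S H)

/-- The Möbius condition: `Σ_{m′ ∣ m} μ(m/m′)·h_{m′}(S,H) ≥ 0` for all `m ≥ 1`. -/
def MoebiusCond (S : Multiset ℚ) (H : ℚ) : Prop :=
  ∀ m : ℕ, 0 < m →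
    0 ≤ ∑ m' ∈ m.divisors, (ArithmeticFunction.moebius (m / m') : ℚ) * hS m' S H

/-- The excess `Σ_{1 ≤ j ≤ m} max(0, m·a − j·N)` of the fraction `a / N`, encoded as `(a, N)`. -/
def excess (m : ℕ) (p : ℕ × ℕ) : ℕ := ∑ j ∈ Finset.range m, (m * p.1 - (j + 1) * p.2)

/-- The linear functionals constraining the search: the denominator (index `0`),
the numerator (index `1`), and the excesses. -/
def weight (m : ℕ) (p : ℕ × ℕ) : ℕ :=
  if m = 0 then p.2 else if m = 1 then p.1 else excess m p

/-- The prescribed total of each functional. -/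
def target (m : ℕ) : ℕ :=
  if m = 0 then 36 else if m = 1 then 9 else 3 * ((m - 1) * (m - 2) / 2)

/-- The order in which the functionals are used. -/
def stages : List ℕ := [3, 4, 5, 6, 7, 8, 9, 1, 0]

/-- The total weight of a list of fractions. -/
def total (m : ℕ) (c : List (ℕ × ℕ)) : ℕ := (c.map (weight m)).sum

/-- No functional exceeds its target. -/
def fits (c : List (ℕ × ℕ)) : Bool := stages.all fun m => total m c ≤ target m

/-- All ways (with at most `n` steps) to enlarge `c` by elements of a list so that the functional
`k` attains its target. -/
def extend (k : ℕ) : ℕ → List (ℕ × ℕ) → List (ℕ × ℕ) → List (List (ℕ × ℕ))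
  | 0, _, _ => []
  | _ + 1, [], c => if total k c = target k then [c] else []
  | n + 1, t :: L, c =>
    if total k c = target k then [c] else
      (if fits (t :: c) then extend k n (t :: L) (t :: c) else []) ++ extend k n L c

/-- Enlarge `c` by elements of `L`, saturating the functionals of the given list one by one. -/
def search : List ℕ → List (ℕ × ℕ) → List (ℕ × ℕ) → List (List (ℕ × ℕ))
  | [], _, c => [c]
  | k :: ks, L, c =>
    (extend k 600 (L.filter fun t => 0 < weight k t) c).flatMap
      (search ks (L.filter fun t => weight k t = 0))

/-- The reduced fractions in `[0, 1/2]` with numerator at most `9` and denominator at most `36`. -/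
def fractions : List (ℕ × ℕ) :=
  (List.range 10 ×ˢ List.range 37).filter fun p => 2 * p.1 ≤ p.2 ∧ 0 < p.2 ∧ Nat.gcd p.1 p.2 = 1

theorem filter_search_eq : (search stages fractions []).filter (fun c => 108 ≤ total 10 c) =
    [[(0, 1), (0, 1), (0, 1), (0, 1), (1, 8), (1, 5), (1, 4), (1, 3), (1, 3), (3, 7), (1, 2)]] := by
  decide +kernel

/-- The total weight of a multiset of fractions. -/
def msTotal (m : ℕ) (M : Multiset (ℕ × ℕ)) : ℕ := (M.map (weight m)).sum

theorem msTotal_coe (m : ℕ) (c : List (ℕ × ℕ)) : msTotal m c = total m c := by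
  simp [msTotal, total]

theorem msTotal_add (m : ℕ) (M M' : Multiset (ℕ × ℕ)) :
    msTotal m (M + M') = msTotal m M + msTotal m M' := by
  simp [msTotal]

theorem msTotal_cons (m : ℕ) (t : ℕ × ℕ) (M : Multiset (ℕ × ℕ)) :
    msTotal m (t ::ₘ M) = weight m t + msTotal m M := by
  simp [msTotal]

theorem total_cons (m : ℕ) (t : ℕ × ℕ) (c : List (ℕ × ℕ)) :
    total m (t :: c) = weight m t + total m c := by
  simp [total]

theorem eq_zero_of_msTotal_eq_zero {m : ℕ} {M : Multiset (ℕ × ℕ)}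
    (hpos : ∀ p ∈ M, 0 < weight m p) (h : msTotal m M = 0) : M = 0 := by
  refine Multiset.eq_zero_of_forall_notMem fun p hp => ?_
  obtain ⟨M', rfl⟩ := Multiset.exists_cons_of_mem hp
  have := hpos p hp
  rw [msTotal_cons] at h
  omega

theorem exists_mem_extend (k : ℕ) : ∀ (n : ℕ) (L c : List (ℕ × ℕ)) (M : Multiset (ℕ × ℕ)),
    (∀ t ∈ L, 0 < weight k t) → (∀ p ∈ M, p ∈ L) →
    (∀ m ∈ stages, total m c + msTotal m M ≤ target m) →
    total k c + msTotal k M = target k → L.length + M.card < n →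
    ∃ c' ∈ extend k n L c, (c' : Multiset (ℕ × ℕ)) = M + c := by
  intro n
  induction n with
  | zero => intro L c M _ _ _ _ h; omega
  | succ n ih =>
    intro L c M hpos hM hle heq hn
    match L with
    | [] =>
      obtain rfl : M = 0 := Multiset.eq_zero_of_forall_notMem fun p hp => by simpa using hM p hp
      have h : total k c = target k := by simpa [msTotal] using heq
      exact ⟨c, by simp [extend, h], by simp⟩
    | t :: L =>
      by_cases h : total k c = target k
      · obtain rfl : M = 0 :=
          eq_zero_of_msTotal_eq_zero (m := k) (fun p hp => hpos p (hM p hp)) (by omega)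
        exact ⟨c, by simp [extend, h], by simp⟩
      · by_cases ht : t ∈ M
        · obtain ⟨M', rfl⟩ := Multiset.exists_cons_of_mem ht
          have hle' : ∀ m ∈ stages, total m (t :: c) + msTotal m M' ≤ target m := fun m hm => by
            have := hle m hm
            rw [msTotal_cons] at this
            rw [total_cons]
            omega
          have hfit : fits (t :: c) = true := by
            simp only [fits, List.all_eq_true, decide_eq_true_eq]
            intro m hm
            have := hle' m hm
            omega
          rw [msTotal_cons] at heq
          rw [Multiset.card_cons] at hn
          obtain ⟨c', hc', he⟩ := ih (t :: L) (t :: c) M' hpos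
            (fun p hp => hM p (Multiset.mem_cons_of_mem hp)) hle'
            (by rw [total_cons]; omega) (by omega)
          refine ⟨c', by simp [extend, h, hfit, hc'], ?_⟩
          rw [he, ← Multiset.cons_coe, Multiset.add_cons, Multiset.cons_add]
        · have hML : ∀ p ∈ M, p ∈ L := fun p hp => by
            rcases List.mem_cons.1 (hM p hp) with rfl | h
            · exact absurd hp ht
            · exact h
          obtain ⟨c', hc', he⟩ := ih L c M (fun p hp => hpos p (List.mem_cons_of_mem _ hp)) hML
            hle heq (by simp only [List.length_cons] at hn; omega)
          exact ⟨c', by simp [extend, h, hc'], he⟩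

theorem exists_mem_search : ∀ (ks : List ℕ) (L c : List (ℕ × ℕ)) (M : Multiset (ℕ × ℕ)),
    (∀ k ∈ ks, k ∈ stages) → (∀ p ∈ M, p ∈ L) → (∀ p ∈ M, ∃ k ∈ ks, 0 < weight k p) →
    (∀ m ∈ stages, total m c + msTotal m M = target m) → L.length + M.card < 600 →
    ∃ c' ∈ search ks L c, (c' : Multiset (ℕ × ℕ)) = M + c := by
  intro ks
  induction ks with
  | nil =>
    intro L c M _ _ hk _ _
    obtain rfl : M = 0 := Multiset.eq_zero_of_forall_notMem fun p hp => by simpa using hk p hp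
    exact ⟨c, by simp [search], by simp⟩
  | cons k ks ih =>
    intro L c M hks hM hk htot hn
    set M₁ := M.filter fun p => 0 < weight k p with hM₁
    set M₂ := M.filter fun p => ¬ 0 < weight k p with hM₂
    have hadd : M₁ + M₂ = M := Multiset.filter_add_not _ _
    have hz : msTotal k M₂ = 0 := by
      refine Multiset.sum_eq_zero fun x hx => ?_
      obtain ⟨p, hp, rfl⟩ := Multiset.mem_map.1 hx
      have := (Multiset.mem_filter.1 hp).2
      omega
    have hsum : ∀ m, msTotal m M = msTotal m M₁ + msTotal m M₂ := fun m => by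
      rw [← msTotal_add, hadd]
    have hcard : M.card = M₁.card + M₂.card := by rw [← Multiset.card_add, hadd]
    obtain ⟨c₁, hc₁, he₁⟩ := exists_mem_extend k 600 (L.filter fun t => 0 < weight k t) c M₁
      (fun t ht => by simpa using (List.mem_filter.1 ht).2)
      (fun p hp => by
        obtain ⟨h1, h2⟩ := Multiset.mem_filter.1 hp
        exact List.mem_filter.2 ⟨hM p h1, by simpa using h2⟩)
      (fun m hm => by have := htot m hm; have := hsum m; omega)
      (by have := htot k (hks k (by simp)); have := hsum k; omega)
      (by
        have := List.length_filter_le (fun t => decide (0 < weight k t)) L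
        omega)
    obtain ⟨c₂, hc₂, he₂⟩ := ih (L.filter fun t => weight k t = 0) c₁ M₂
      (fun j hj => hks j (List.mem_cons_of_mem _ hj))
      (fun p hp => by
        obtain ⟨h1, h2⟩ := Multiset.mem_filter.1 hp
        exact List.mem_filter.2 ⟨hM p h1, by simpa using h2⟩)
      (fun p hp => by
        obtain ⟨h1, h2⟩ := Multiset.mem_filter.1 hp
        obtain ⟨j, hj, hpos⟩ := hk p h1
        rcases List.mem_cons.1 hj with rfl | hj
        · exact absurd hpos h2
        · exact ⟨j, hj, hpos⟩)
      (fun m hm => by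
        have := htot m hm
        have := hsum m
        rw [← msTotal_coe, he₁, msTotal_add, msTotal_coe]
        omega)
      (by
        have := List.length_filter_le (fun t => decide (weight k t = 0)) L
        omega)
    refine ⟨c₂, List.mem_flatMap.2 ⟨c₁, hc₁, hc₂⟩, ?_⟩
    rw [he₂, he₁, ← hadd, ← add_assoc, add_comm M₂]

theorem two_mul_sum_sub (N q r n : ℕ) (hr : r < N) :
    2 * ∑ j ∈ Finset.range (q + n), (N * q + r - (j + 1) * N) = N * q * (q - 1) + 2 * q * r := by
  rw [Finset.sum_range_add, Finset.sum_eq_zero (s := Finset.range n), add_zero]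
  · induction q with
    | zero => simp
    | succ q ih =>
      rw [Finset.sum_range_succ']
      have : ∀ j, N * (q + 1) + r - (j + 1 + 1) * N = N * q + r - (j + 1) * N := fun j => by
        rw [show N * (q + 1) + r = N + (N * q + r) by ring,
          show (j + 1 + 1) * N = N + (j + 1) * N by ring, Nat.add_sub_add_left]
      rw [Finset.sum_congr rfl fun j _ => this j, mul_add, ih]
      rw [show N * (q + 1) + r - (0 + 1) * N = N * q + r by
        rw [show N * (q + 1) + r = N * q + r + (0 + 1) * N by ring, Nat.add_sub_cancel]]
      cases q with
      | zero => simp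
      | succ q => simp; ring
  · intro j _
    apply Nat.sub_eq_zero_of_le
    nlinarith [Nat.zero_le (j * N)]

theorem fract_natCast_div (x N : ℕ) : Int.fract ((x : ℚ) / N) = ((x % N : ℕ) : ℚ) / N :=
  Int.fract_div_natCast_eq_div_natCast_mod

theorem mul_bernB_natCast_mul (a N m : ℕ) (hN : 0 < N) (ha : 2 * a ≤ N) :
    (N : ℚ) * bernB (m * (a / N)) = m ^ 2 * (N * bernB (a / N)) - (m ^ 2 - 1) / 6 * N
      + m * (m - 1) * a - 2 * excess m (a, N) := by
  have hN' : (N : ℚ) ≠ 0 := by positivity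
  obtain ⟨q, hq⟩ : ∃ q, q = m * a / N := ⟨_, rfl⟩
  obtain ⟨r, hr⟩ : ∃ r, r = m * a % N := ⟨_, rfl⟩
  have hdiv : N * q + r = m * a := by rw [hq, hr, Nat.div_add_mod]
  have hrN : r < N := hr ▸ Nat.mod_lt _ hN
  have hqm : q ≤ m := by
    rw [hq]
    exact Nat.div_le_of_le_mul (by nlinarith)
  obtain ⟨n, rfl⟩ := Nat.exists_eq_add_of_le hqm
  have hex : (2 : ℚ) * excess (q + n) (a, N) = N * q * (q - 1) + 2 * q * r := by
    have := two_mul_sum_sub N q r n hrN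
    rw [hdiv] at this
    rcases q with _ | q
    · have h0 : 2 * excess (0 + n) (a, N) = 0 := by rw [excess, this]; simp
      have h0' : (2 : ℚ) * excess (0 + n) (a, N) = 0 := by exact_mod_cast h0
      rw [h0']
      simp
    · have h : ((q + 1 : ℕ) : ℚ) - 1 = ((q + 1 - 1 : ℕ) : ℚ) := by simp
      rw [h]
      exact_mod_cast this
  have hx : (N : ℚ) * q + r = ((q + n : ℕ) : ℚ) * a := by exact_mod_cast hdiv
  rw [hex, ← mul_div_assoc, ← Nat.cast_mul, bernB, bernB, fract_natCast_div, fract_natCast_div,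
    ← hr, Nat.mod_eq_of_lt (show a < N by omega)]
  have hr' : (r : ℚ) = ((q + n : ℕ) : ℚ) * a - N * q := by linarith
  rw [hr']
  field_simp
  ring

/-- The numerator and denominator of a rational number. -/
def code (z : ℚ) : ℕ × ℕ := (z.num.toNat, z.den)

theorem code_div {z : ℚ} (hz : 0 ≤ z) : ((code z).1 : ℚ) / (code z).2 = z := by
  have h : ((z.num.toNat : ℕ) : ℤ) = z.num := Int.toNat_of_nonneg (Rat.num_nonneg.2 hz)
  have h' : ((z.num.toNat : ℕ) : ℚ) = (z.num : ℚ) := by exact_mod_cast h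
  rw [code, h', Rat.num_div_den]

theorem two_mul_code_fst_le {z : ℚ} (hz : 0 ≤ z) (hz' : z ≤ 1 / 2) :
    2 * (code z).1 ≤ (code z).2 := by
  have h := code_div hz
  have hN : (0 : ℚ) < (code z).2 := by exact_mod_cast z.den_pos
  rw [div_eq_iff hN.ne'] at h
  have : (2 : ℚ) * (code z).1 ≤ (code z).2 := by rw [h]; nlinarith
  exact_mod_cast this

theorem lamS_eq (m : ℕ) (S : Multiset ℚ) (hS : ∀ z ∈ S, 0 ≤ z ∧ z ≤ 1 / 2) :
    lamS m S = m ^ 2 * lamS 1 S - (m ^ 2 - 1) / 6 * dS S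
      + m * (m - 1) * msTotal 1 (S.map code) - 2 * ((S.map code).map (excess m)).sum := by
  induction S using Multiset.induction_on with
  | empty => simp [lamS, dS, msTotal]
  | cons z S ih =>
    have ih := ih fun w hw => hS w (Multiset.mem_cons_of_mem hw)
    obtain ⟨h0, h1⟩ := hS z (Multiset.mem_cons_self z S)
    have key := mul_bernB_natCast_mul (code z).1 (code z).2 m z.den_pos (two_mul_code_fst_le h0 h1)
    rw [code_div h0] at key
    have hden : ((code z).2 : ℚ) = z.den := rfl
    have hw : weight 1 (code z) = (code z).1 := rfl
    rw [hden] at key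
    simp only [lamS, dS, msTotal, Multiset.map_cons, Multiset.sum_cons, Nat.cast_add, hw,
      Nat.cast_one, one_mul] at ih ⊢
    rw [ih, key]
    ring

theorem hS_eq (m : ℕ) (S : Multiset ℚ) (H : ℚ) (hS' : ∀ z ∈ S, 0 ≤ z ∧ z ≤ 1 / 2)
    (hd : dS S = 36) (h1 : hS 1 S H = 0) :
    hS m S H = 6 * (m ^ 2 - 1) - m * (m - 1) * msTotal 1 (S.map code)
      + 2 * ((S.map code).map (excess m)).sum := by
  have h : H = lamS 1 S := by simpa [hS, sub_eq_zero] using h1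
  rw [hS, lamS_eq m S hS', hd, h]
  push_cast
  ring

theorem excess_two_eq_zero {p : ℕ × ℕ} (hp : 2 * p.1 ≤ p.2) : excess 2 p = 0 := by
  simp only [excess, Finset.sum_range_succ, Finset.sum_range_zero]
  omega

theorem stmt_18 (S : Multiset ℚ) (H : ℚ) (hadm : Admissible S H)
    (hd : dS S = 36) (hzero : ∀ m : ℕ, 1 ≤ m → m ≤ 9 → hS m S H = 0) :
    H = 23 / 840 ∧
      S = ({1 / 8, 3 / 7, 1 / 5, 1 / 4, 1 / 3, 1 / 3, 1 / 2, 0, 0, 0, 0} : Multiset ℚ) := by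
  obtain ⟨hS', -, heven, -⟩ := hadm
  have h1 : hS 1 S H = 0 := hzero 1 le_rfl (by norm_num)
  have hform := fun m => hS_eq m S H hS' hd h1
  have hdS : msTotal 0 (S.map code) = 36 := by
    rw [← hd, msTotal, dS, Multiset.map_map]
    rfl
  have hnum : msTotal 1 (S.map code) = 9 := by
    have h := hform 2
    have hz : ((S.map code).map (excess 2)).sum = 0 := by
      refine Multiset.sum_eq_zero fun x hx => ?_
      simp only [Multiset.mem_map] at hx
      obtain ⟨p, ⟨z, hz, rfl⟩, rfl⟩ := hx
      exact excess_two_eq_zero (two_mul_code_fst_le (hS' z hz).1 (hS' z hz).2)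
    rw [hzero 2 (by norm_num) (by norm_num), hz] at h
    have : (msTotal 1 (S.map code) : ℚ) = 9 := by push_cast at h; linarith
    exact_mod_cast this
  have hexc : ∀ m, 3 ≤ m → m ≤ 9 → msTotal m (S.map code) = target m := by
    intro m hm hm'
    have h := hform m
    rw [hzero m (by omega) hm', hnum] at h
    have hw : ((S.map code).map (excess m)).sum = msTotal m (S.map code) := by
      rw [msTotal]
      congr 2
      funext p
      simp [weight, show m ≠ 0 by omega, show m ≠ 1 by omega]
    rw [hw] at h
    have : (msTotal m (S.map code) : ℚ) = target m := by
      interval_cases m <;> norm_num [target] at h ⊢ <;> linarith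
    exact_mod_cast this
  have htot : ∀ m ∈ stages, total m [] + msTotal m (S.map code) = target m := by
    intro m hm
    have h0 : total m [] = 0 := rfl
    rw [h0, zero_add]
    simp only [stages, List.mem_cons, List.not_mem_nil, or_false] at hm
    rcases hm with rfl | rfl | rfl | rfl | rfl | rfl | rfl | rfl | rfl
    on_goal 8 => exact hnum
    on_goal 8 => exact hdS
    all_goals exact hexc _ (by norm_num) (by norm_num)
  have hten : 108 ≤ msTotal 10 (S.map code) := by
    have h := hform 10
    obtain ⟨k, hk⟩ := heven 10 (by norm_num)
    have hw : ((S.map code).map (excess 10)).sum = msTotal 10 (S.map code) := rfl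
    rw [hk, hnum, hw] at h
    have hk0 : (0 : ℚ) ≤ k := by positivity
    have : (108 : ℚ) ≤ msTotal 10 (S.map code) := by push_cast at h; linarith
    exact_mod_cast this
  have hle : ∀ m, ∀ z ∈ S, weight m (code z) ≤ msTotal m (S.map code) := fun m z hz =>
    Multiset.single_le_sum (fun _ _ => Nat.zero_le _) _
      (Multiset.mem_map_of_mem _ (Multiset.mem_map_of_mem _ hz))
  have hmem : ∀ p ∈ S.map code, p ∈ fractions := by
    intro p hp
    obtain ⟨z, hz, rfl⟩ := Multiset.mem_map.1 hp
    have ha : (code z).1 ≤ 9 := hnum ▸ hle 1 z hz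
    have hN : (code z).2 ≤ 36 := hdS ▸ hle 0 z hz
    have h2 := two_mul_code_fst_le (hS' z hz).1 (hS' z hz).2
    have hpos : 0 < (code z).2 := z.den_pos
    have hcop : Nat.gcd (code z).1 (code z).2 = 1 := by
      have := z.reduced
      rwa [← Int.toNat_of_nonneg (Rat.num_nonneg.2 (hS' z hz).1), Int.natAbs_natCast] at this
    simp only [fractions, List.mem_filter, decide_eq_true_eq]
    exact ⟨List.mem_product.2 ⟨List.mem_range.2 (Nat.lt_succ_of_le ha),
        List.mem_range.2 (Nat.lt_succ_of_le hN)⟩,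
      h2, hpos, hcop⟩
  have hcard : (S.map code).card ≤ 36 := by
    rw [← hdS, msTotal]
    refine le_trans ?_ (Multiset.card_nsmul_le_sum (a := 1) fun x hx => ?_)
    · simp
    · simp only [Multiset.mem_map] at hx
      obtain ⟨p, ⟨z, hz, rfl⟩, rfl⟩ := hx
      exact z.den_pos
  obtain ⟨c, hc, hcS⟩ := exists_mem_search stages fractions [] (S.map code) (fun _ h => h) hmem
    (fun p hp => ⟨0, by decide, by
      obtain ⟨z, hz, rfl⟩ := Multiset.mem_map.1 hp
      exact z.den_pos⟩) htot (by
      have : fractions.length = 156 := by decide +kernel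
      omega)
  rw [Multiset.coe_nil, add_zero] at hcS
  rw [← hcS, msTotal_coe] at hten
  have hc' : c ∈ (search stages fractions []).filter (fun c => 108 ≤ total 10 c) :=
    List.mem_filter.2 ⟨hc, by simpa using hten⟩
  rw [filter_search_eq, List.mem_singleton] at hc'
  have hSeq : S = (S.map code).map fun p => (p.1 : ℚ) / p.2 := by
    rw [Multiset.map_map]
    conv_lhs => rw [← Multiset.map_id S]
    exact Multiset.map_congr rfl fun z hz => (code_div (hS' z hz).1).symm
  have hfin : S = ({1 / 8, 3 / 7, 1 / 5, 1 / 4, 1 / 3, 1 / 3, 1 / 2, 0, 0, 0, 0} : Multiset ℚ) := by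
    rw [hSeq, ← hcS, hc']
    simp only [Multiset.map_coe, List.map_cons, List.map_nil]
    norm_num
    decide +kernel
  refine ⟨?_, hfin⟩
  have h : H = lamS 1 S := by simpa [hS, sub_eq_zero] using h1
  rw [h, hfin]
  decide +kernel
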